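/- arXiv:2106.14743 — 9 statements merged into one kernel-verified Lean document; each statement's English description precedes it below -/
import Mathlib

section
/- Let A, X, Y be sets and f1 : A → X, f2 : A → Y maps, so that (A, f1, f2) is a span from X to Y. Then the following are equivalent: (i) there exist a set B and maps g1 : B → Y, g2 : B → X together with a bijection φ : X → {(a,b) ∈ A × B : f2(a) = g1(b)} satisfying f1((φ x).1) = x and g2((φ x).2) = x for all x ∈ X, and a bijection φ' : Y → {(b,a) ∈ B × A : g2(b) = f1(a)} satisfying g1((φ' y).1) = y and f2((φ' y).2) = y for all y ∈ Y; (ii) f1 and f2 are both bijections. (This says that a span represents an isomorphism in the category Span if and only if its two legs are bijections.) -/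
/-- A span `(A, f1, f2)` from `X` to `Y` represents an isomorphism in the category
`Span` (i.e. admits an inverse span `(B, g1, g2)` with both composites isomorphic to
identity spans) if and only if both legs `f1` and `f2` are bijections. -/
theorem span_represents_iso_iff_legs_bijective
    {A X Y : Type} (f1 : A → X) (f2 : A → Y) :
    (∃ (B : Type) (g1 : B → Y) (g2 : B → X)
        (φ : X ≃ {p : A × B // f2 p.1 = g1 p.2})
        (φ' : Y ≃ {p : B × A // g2 p.1 = f1 p.2}),
        (∀ x : X, f1 (φ x).1.1 = x ∧ g2 (φ x).1.2 = x) ∧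
        (∀ y : Y, g1 (φ' y).1.1 = y ∧ f2 (φ' y).1.2 = y)) ↔
      (Function.Bijective f1 ∧ Function.Bijective f2) := by
  constructor
  · rintro ⟨B, g1, g2, φ, φ', h, h'⟩
    have key : ∀ a b, f2 a = g1 b → ∃ x, (φ x).1 = (a, b) ∧ f1 a = x ∧ g2 b = x := by
      intro a b hab
      obtain ⟨x, hx⟩ := φ.surjective ⟨(a, b), hab⟩
      have := h x
      rw [hx] at this
      exact ⟨x, by rw [hx], this⟩
    have key' : ∀ b a, g2 b = f1 a → ∃ y, (φ' y).1 = (b, a) ∧ g1 b = y ∧ f2 a = y := by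
      intro b a hab
      obtain ⟨y, hy⟩ := φ'.surjective ⟨(b, a), hab⟩
      have := h' y
      rw [hy] at this
      exact ⟨y, by rw [hy], this⟩
    refine ⟨⟨?_, fun x => ⟨_, (h x).1⟩⟩, ⟨?_, fun y => ⟨_, (h' y).2⟩⟩⟩
    · intro a a' haa
      obtain ⟨x, -, h1, h2⟩ := key a (φ' (f2 a)).1.1 (h' (f2 a)).1.symm
      obtain ⟨y, e, h3, -⟩ := key' _ a (h2.trans h1.symm)
      obtain ⟨y', e', h3', -⟩ := key' _ a' ((h2.trans h1.symm).trans haa)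
      have hy : y = y' := h3.symm.trans h3'
      subst hy
      exact congrArg Prod.snd (e.symm.trans e')
    · intro a a' haa
      have hb := (h' (f2 a)).1.symm
      obtain ⟨x, e, -, h3⟩ := key a _ hb
      obtain ⟨x', e', -, h3'⟩ := key a' _ (haa.symm.trans hb)
      have hx : x = x' := h3.symm.trans h3'
      subst hx
      exact congrArg Prod.fst (e.symm.trans e')
  · rintro ⟨h1, h2⟩
    let e1 := Equiv.ofBijective f1 h1
    let e2 := Equiv.ofBijective f2 h2
    have k1 : ∀ x, f1 (e1.symm x) = x := e1.apply_symm_apply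
    have k2 : ∀ y, f2 (e2.symm y) = y := e2.apply_symm_apply
    refine ⟨A, f2, f1,
      Equiv.ofBijective (fun x => ⟨(e1.symm x, e1.symm x), rfl⟩) ⟨?_, ?_⟩,
      Equiv.ofBijective (fun y => ⟨(e2.symm y, e2.symm y), rfl⟩) ⟨?_, ?_⟩,
      fun x => ⟨k1 x, k1 x⟩, fun y => ⟨k2 y, k2 y⟩⟩
    · intro x x' hx
      exact e1.symm.injective (congrArg (fun p => p.1.1) hx)
    · rintro ⟨⟨a, b⟩, hab⟩
      obtain rfl : a = b := h2.1 hab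
      have : e1.symm (f1 a) = a := e1.symm_apply_apply a
      exact ⟨f1 a, Subtype.ext (by simp only [this])⟩
    · intro x x' hx
      exact e2.symm.injective (congrArg (fun p => p.1.1) hx)
    · rintro ⟨⟨a, b⟩, hab⟩
      obtain rfl : a = b := h1.1 hab
      have : e2.symm (f2 a) = a := e2.symm_apply_apply a
      exact ⟨f2 a, Subtype.ext (by simp only [this])⟩
end

section
/- Let 𝒳 be a 2-truncated simplicial set. Then (LU) holds if and only if condition (U1) holds, and (RU) holds if and only if condition (U2) holds. (This says the unit axiom for the monoid structure on X1 in the category Span, with unit represented by the span (X0, !, s_0^0) and multiplication by the span (X2, (d_2^2, d_0^2), d_1^2), is equivalent to conditions (U1) and (U2).) -/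
/-- A 2-truncated simplicial set: sets `X0, X1, X2` with face maps
`d10, d11 : X1 → X0` and `d20, d21, d22 : X2 → X1` (where `dqi` stands for `d_i^q`),
and degeneracy maps `s00 : X0 → X1` and `s01, s11 : X1 → X2` (where `sqi` stands
for `s_i^q`), satisfying the simplicial identities. -/
structure TwoTruncSS where
  X0 : Type
  X1 : Type
  X2 : Type
  d10 : X1 → X0
  d11 : X1 → X0
  d20 : X2 → X1
  d21 : X2 → X1
  d22 : X2 → X1
  s00 : X0 → X1
  s01 : X1 → X2
  s11 : X1 → X2
  face1 : ∀ ζ, d10 (d21 ζ) = d10 (d20 ζ)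
  face2 : ∀ ζ, d10 (d22 ζ) = d11 (d20 ζ)
  face3 : ∀ ζ, d11 (d22 ζ) = d11 (d21 ζ)
  degen : ∀ u, s01 (s00 u) = s11 (s00 u)
  ds1 : ∀ u, d10 (s00 u) = u
  ds2 : ∀ u, d11 (s00 u) = u
  ds3 : ∀ x, d20 (s01 x) = x
  ds4 : ∀ x, d21 (s01 x) = x
  ds5 : ∀ x, d22 (s01 x) = s00 (d11 x)
  ds6 : ∀ x, d20 (s11 x) = s00 (d10 x)
  ds7 : ∀ x, d21 (s11 x) = x
  ds8 : ∀ x, d22 (s11 x) = x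

/-- (LU): the span-theoretic left unit equation `μ ∘ (η × 1) = 1`. -/
def TwoTruncSS.LU (𝒳 : TwoTruncSS) : Prop :=
  ∃ φ : {ζ : 𝒳.X2 // 𝒳.d22 ζ ∈ Set.range 𝒳.s00} ≃ 𝒳.X1,
    ∀ ζ, 𝒳.d20 ζ.1 = φ ζ ∧ 𝒳.d21 ζ.1 = φ ζ

/-- (RU): the span-theoretic right unit equation `μ ∘ (1 × η) = 1`. -/
def TwoTruncSS.RU (𝒳 : TwoTruncSS) : Prop :=
  ∃ φ : {ζ : 𝒳.X2 // 𝒳.d20 ζ ∈ Set.range 𝒳.s00} ≃ 𝒳.X1,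
    ∀ ζ, 𝒳.d22 ζ.1 = φ ζ ∧ 𝒳.d21 ζ.1 = φ ζ

/-- (U1): every 2-simplex whose `d_2^2`-face is degenerate lies in the range of `s_0^1`. -/
def TwoTruncSS.U1 (𝒳 : TwoTruncSS) : Prop :=
  ∀ ζ : 𝒳.X2, 𝒳.d22 ζ ∈ Set.range 𝒳.s00 → ζ ∈ Set.range 𝒳.s01

/-- (U2): every 2-simplex whose `d_0^2`-face is degenerate lies in the range of `s_1^1`. -/
def TwoTruncSS.U2 (𝒳 : TwoTruncSS) : Prop :=
  ∀ ζ : 𝒳.X2, 𝒳.d20 ζ ∈ Set.range 𝒳.s00 → ζ ∈ Set.range 𝒳.s11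

/-- The set of (02)-tacos: pairs `(ζ, ζ')` with `d_1^2 ζ = d_0^2 ζ'`. -/
def TwoTruncSS.T02 (𝒳 : TwoTruncSS) :=
  {p : 𝒳.X2 × 𝒳.X2 // 𝒳.d21 p.1 = 𝒳.d20 p.2}

/-- The set of (13)-tacos: pairs `(ζ, ζ')` with `d_2^2 ζ = d_1^2 ζ'`. -/
def TwoTruncSS.T13 (𝒳 : TwoTruncSS) :=
  {p : 𝒳.X2 × 𝒳.X2 // 𝒳.d22 p.1 = 𝒳.d21 p.2}

/-- The codomain of the associativity bijection: pairs `(ζ'', ζ''')` with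
`d_1^2 ζ'' = d_2^2 ζ'''`. -/
def TwoTruncSS.P13 (𝒳 : TwoTruncSS) :=
  {p : 𝒳.X2 × 𝒳.X2 // 𝒳.d21 p.1 = 𝒳.d22 p.2}

/-- Boundary map `∂02(ζ,ζ') = (d_2^2 ζ', d_2^2 ζ, d_0^2 ζ, d_1^2 ζ')`. -/
def TwoTruncSS.bd02 (𝒳 : TwoTruncSS) (p : 𝒳.T02) :
    𝒳.X1 × 𝒳.X1 × 𝒳.X1 × 𝒳.X1 :=
  (𝒳.d22 p.1.2, 𝒳.d22 p.1.1, 𝒳.d20 p.1.1, 𝒳.d21 p.1.2)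

/-- Boundary map `∂13(ζ,ζ') = (d_2^2 ζ', d_0^2 ζ', d_0^2 ζ, d_1^2 ζ)`. -/
def TwoTruncSS.bd13 (𝒳 : TwoTruncSS) (p : 𝒳.T13) :
    𝒳.X1 × 𝒳.X1 × 𝒳.X1 × 𝒳.X1 :=
  (𝒳.d22 p.1.2, 𝒳.d20 p.1.2, 𝒳.d20 p.1.1, 𝒳.d21 p.1.1)

/-- (A): the span-theoretic associativity equation `μ ∘ (1 × μ) = μ ∘ (μ × 1)`. -/
def TwoTruncSS.AssocA (𝒳 : TwoTruncSS) : Prop :=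
  ∃ Ψ : 𝒳.T02 ≃ 𝒳.P13, ∀ p : 𝒳.T02,
    𝒳.d22 (Ψ p).1.1 = 𝒳.d22 p.1.2 ∧ 𝒳.d20 (Ψ p).1.1 = 𝒳.d22 p.1.1 ∧
    𝒳.d20 (Ψ p).1.2 = 𝒳.d20 p.1.1 ∧ 𝒳.d21 (Ψ p).1.2 = 𝒳.d21 p.1.2

/-- The Θ-condition: a bijection `Θ : T02 → T13` commuting with the boundary maps. -/
def TwoTruncSS.ThetaCond (𝒳 : TwoTruncSS) : Prop :=
  ∃ Θ : 𝒳.T02 ≃ 𝒳.T13, ∀ p, 𝒳.bd13 (Θ p) = 𝒳.bd02 p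

/-- In a 2-truncated simplicial set, the left unit equation (LU) holds iff
condition (U1) holds, and the right unit equation (RU) holds iff condition (U2)
holds: the unit axiom for the monoid structure on `X1` in `Span` (with unit
represented by `(X0, !, s_0^0)` and multiplication by `(X2, (d_2^2, d_0^2), d_1^2)`)
is equivalent to (U1) and (U2). -/
theorem unit_axiom_iff_U1_U2 (𝒳 : TwoTruncSS) :
    (𝒳.LU ↔ 𝒳.U1) ∧ (𝒳.RU ↔ 𝒳.U2) := by
  refine ⟨⟨?_, ?_⟩, ⟨?_, ?_⟩⟩
  · rintro ⟨φ, h⟩ ζ hζ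
    refine ⟨𝒳.d20 ζ, ?_⟩
    have hs : 𝒳.d22 (𝒳.s01 (𝒳.d20 ζ)) ∈ Set.range 𝒳.s00 := ⟨_, (𝒳.ds5 _).symm⟩
    have e : φ ⟨_, hs⟩ = φ ⟨ζ, hζ⟩ := by
      rw [← (h ⟨_, hs⟩).1, ← (h ⟨ζ, hζ⟩).1]
      exact 𝒳.ds3 _
    exact congrArg Subtype.val (φ.injective e)
  · intro h
    refine ⟨⟨fun ζ => 𝒳.d20 ζ.1, fun x => ⟨𝒳.s01 x, ⟨_, (𝒳.ds5 x).symm⟩⟩, ?_, ?_⟩, ?_⟩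
    · rintro ⟨ζ, hζ⟩
      obtain ⟨x, rfl⟩ := h ζ hζ
      exact Subtype.ext (congrArg 𝒳.s01 (𝒳.ds3 x))
    · intro x
      exact 𝒳.ds3 x
    · rintro ⟨ζ, hζ⟩
      obtain ⟨x, rfl⟩ := h ζ hζ
      exact ⟨rfl, (𝒳.ds4 x).trans (𝒳.ds3 x).symm⟩
  · rintro ⟨φ, h⟩ ζ hζ
    refine ⟨𝒳.d22 ζ, ?_⟩
    have hs : 𝒳.d20 (𝒳.s11 (𝒳.d22 ζ)) ∈ Set.range 𝒳.s00 := ⟨_, (𝒳.ds6 _).symm⟩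
    have e : φ ⟨_, hs⟩ = φ ⟨ζ, hζ⟩ := by
      rw [← (h ⟨_, hs⟩).1, ← (h ⟨ζ, hζ⟩).1]
      exact 𝒳.ds8 _
    exact congrArg Subtype.val (φ.injective e)
  · intro h
    refine ⟨⟨fun ζ => 𝒳.d22 ζ.1, fun x => ⟨𝒳.s11 x, ⟨_, (𝒳.ds6 x).symm⟩⟩, ?_, ?_⟩, ?_⟩
    · rintro ⟨ζ, hζ⟩
      obtain ⟨x, rfl⟩ := h ζ hζ
      exact Subtype.ext (congrArg 𝒳.s11 (𝒳.ds8 x))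
    · intro x
      exact 𝒳.ds8 x
    · rintro ⟨ζ, hζ⟩
      obtain ⟨x, rfl⟩ := h ζ hζ
      exact ⟨rfl, (𝒳.ds7 x).trans (𝒳.ds8 x).symm⟩
end

section
/- Let 𝒳 be a 2-truncated simplicial set. Then (LU), (RU) and (A) all hold if and only if (U1), (U2) and the Θ-condition all hold. (This says that the spans (X0, !, s_0^0) and (X2, (d_2^2, d_0^2), d_1^2) make X1 into a monoid in the category Span if and only if (U1), (U2) and the Θ-condition hold.) -/
theorem TwoTruncSS.LU_iff (𝒳 : TwoTruncSS) : 𝒳.LU ↔ 𝒳.U1 := by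
  constructor
  · rintro ⟨φ, h⟩ ζ hζ
    refine ⟨𝒳.d20 ζ, ?_⟩
    have hs : 𝒳.d22 (𝒳.s01 (𝒳.d20 ζ)) ∈ Set.range 𝒳.s00 := ⟨_, (𝒳.ds5 _).symm⟩
    have e : φ ⟨_, hs⟩ = φ ⟨ζ, hζ⟩ := by
      rw [← (h ⟨_, hs⟩).1, ← (h ⟨ζ, hζ⟩).1]
      exact 𝒳.ds3 _
    exact congrArg Subtype.val (φ.injective e)
  · intro h
    refine ⟨⟨fun ζ => 𝒳.d20 ζ.1, fun x => ⟨𝒳.s01 x, _, (𝒳.ds5 x).symm⟩, ?_, fun x => 𝒳.ds3 x⟩, ?_⟩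
    · rintro ⟨ζ, hζ⟩
      obtain ⟨x, rfl⟩ := h ζ hζ
      exact Subtype.ext (congrArg 𝒳.s01 (𝒳.ds3 x))
    · rintro ⟨ζ, hζ⟩
      obtain ⟨x, rfl⟩ := h ζ hζ
      exact ⟨rfl, (𝒳.ds4 x).trans (𝒳.ds3 x).symm⟩

theorem TwoTruncSS.RU_iff (𝒳 : TwoTruncSS) : 𝒳.RU ↔ 𝒳.U2 := by
  constructor
  · rintro ⟨φ, h⟩ ζ hζ
    refine ⟨𝒳.d22 ζ, ?_⟩
    have hs : 𝒳.d20 (𝒳.s11 (𝒳.d22 ζ)) ∈ Set.range 𝒳.s00 := ⟨_, (𝒳.ds6 _).symm⟩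
    have e : φ ⟨_, hs⟩ = φ ⟨ζ, hζ⟩ := by
      rw [← (h ⟨_, hs⟩).1, ← (h ⟨ζ, hζ⟩).1]
      exact 𝒳.ds8 _
    exact congrArg Subtype.val (φ.injective e)
  · intro h
    refine ⟨⟨fun ζ => 𝒳.d22 ζ.1, fun x => ⟨𝒳.s11 x, _, (𝒳.ds6 x).symm⟩, ?_, fun x => 𝒳.ds8 x⟩, ?_⟩
    · rintro ⟨ζ, hζ⟩
      obtain ⟨x, rfl⟩ := h ζ hζ
      exact Subtype.ext (congrArg 𝒳.s11 (𝒳.ds8 x))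
    · rintro ⟨ζ, hζ⟩
      obtain ⟨x, rfl⟩ := h ζ hζ
      exact ⟨rfl, (𝒳.ds7 x).trans (𝒳.ds8 x).symm⟩

/-- Swapping the two entries. -/
def TwoTruncSS.swapE (𝒳 : TwoTruncSS) : 𝒳.P13 ≃ 𝒳.T13 where
  toFun p := ⟨(p.1.2, p.1.1), p.2.symm⟩
  invFun p := ⟨(p.1.2, p.1.1), p.2.symm⟩
  left_inv _ := rfl
  right_inv _ := rfl

theorem TwoTruncSS.A_iff (𝒳 : TwoTruncSS) : 𝒳.AssocA ↔ 𝒳.ThetaCond := by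
  constructor
  · rintro ⟨Ψ, h⟩
    refine ⟨Ψ.trans 𝒳.swapE, fun p => ?_⟩
    obtain ⟨a, b, c, d⟩ := h p
    exact Prod.ext a (Prod.ext b (Prod.ext c d))
  · rintro ⟨Θ, h⟩
    refine ⟨Θ.trans 𝒳.swapE.symm, fun p => ?_⟩
    have e := h p
    simp only [TwoTruncSS.bd13, TwoTruncSS.bd02, Prod.mk.injEq] at e
    exact e

/-- In a 2-truncated simplicial set, the spans `(X0, !, s_0^0)` and
`(X2, (d_2^2, d_0^2), d_1^2)` make `X1` into a monoid in `Span`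
(i.e. (LU), (RU) and (A) all hold) iff (U1), (U2) and the Θ-condition all hold. -/
theorem monoid_iff_U1_U2_theta (𝒳 : TwoTruncSS) :
    (𝒳.LU ∧ 𝒳.RU ∧ 𝒳.AssocA) ↔ (𝒳.U1 ∧ 𝒳.U2 ∧ 𝒳.ThetaCond) := by
  rw [𝒳.LU_iff, 𝒳.RU_iff, 𝒳.A_iff]
end

section
/- Let E, X, M be sets with maps s00 : E → X, d0, d1, d2 : M → X, D0, D1 : X → E, S0, S1 : X → M. Assume: (a) d2∘S1 = id, d1∘S1 = id, d0∘S1 = s00∘D0, and the map x ↦ (D0 x, S1 x) is a bijection from X onto {(e,m) ∈ E × M : s00(e) = d0(m)}; (b) d0∘S0 = id, d1∘S0 = id, d2∘S0 = s00∘D1, and the map x ↦ (D1 x, S0 x) is a bijection from X onto {(e,m) ∈ E × M : s00(e) = d2(m)}; (c) there exists a bijection Ψ from {(m,m') ∈ M × M : d1(m) = d0(m')} to {(n,n') ∈ M × M : d1(n) = d2(n')} such that, writing Ψ(m,m') = (n,n'), one has d2(n) = d2(m'), d0(n) = d2(m), d0(n') = d0(m), d1(n') = d1(m'). Then the following identities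 hold: D0∘d2 = D1∘d0, D1∘d2 = D1∘d1, D0∘d1 = D0∘d0, D0∘s00 = D1∘s00 = id, and S1∘s00 = S0∘s00; consequently (E, X, M) with faces D0, D1 : X → E and d0, d1, d2 : M → X and degeneracies s00, S0, S1 is a 2-truncated simplicial set. (This says that a monoid in the category Span, with unit represented by (E, !, s00) and multiplication by (M, (d2, d0), d1), gives rise to a 2-truncated simplicial set.) -/
/-- A monoid in the category `Span`, with unit represented by the span `(E, !, s00)`
and multiplication by the span `(M, (d2, d0), d1)`, gives rise to a 2-truncated
simplicial set.  Hypotheses (a), (b) encode the two unit equations (with the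
bijections onto the pullbacks computing `μ∘(1×η)` and `μ∘(η×1)`, inducing the maps
`D0, S1` and `D1, S0`), and (c) encodes associativity.  The conclusion consists of
the remaining simplicial identities: `D0∘d2 = D1∘d0`, `D1∘d2 = D1∘d1`,
`D0∘d1 = D0∘d0`, `D0∘s00 = D1∘s00 = id`, and `S1∘s00 = S0∘s00`, so that
`(E, X, M)` with faces `D0, D1 : X → E`, `d0, d1, d2 : M → X` and degeneracies
`s00, S0, S1` is a 2-truncated simplicial set. -/
theorem monoid_in_span_gives_two_truncated_simplicial_set
    {E X M : Type}
    (s00 : E → X) (d0 d1 d2 : M → X) (D0 D1 : X → E) (S0 S1 : X → M)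
    -- (a): the unit equation μ∘(1×η) = 1
    (ha1 : ∀ x, d2 (S1 x) = x)
    (ha2 : ∀ x, d1 (S1 x) = x)
    (ha3 : ∀ x, d0 (S1 x) = s00 (D0 x))
    (ha4 : ∃ e : X ≃ {p : E × M // s00 p.1 = d0 p.2},
      ∀ x, ((e x : E × M) = (D0 x, S1 x)))
    -- (b): the unit equation μ∘(η×1) = 1
    (hb1 : ∀ x, d0 (S0 x) = x)
    (hb2 : ∀ x, d1 (S0 x) = x)
    (hb3 : ∀ x, d2 (S0 x) = s00 (D1 x))
    (hb4 : ∃ e : X ≃ {p : E × M // s00 p.1 = d2 p.2},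
      ∀ x, ((e x : E × M) = (D1 x, S0 x)))
    -- (c): the associativity equation μ∘(1×μ) = μ∘(μ×1)
    (hc : ∃ Ψ : {p : M × M // d1 p.1 = d0 p.2} ≃ {p : M × M // d1 p.1 = d2 p.2},
      ∀ p, d2 (Ψ p).1.1 = d2 p.1.2 ∧ d0 (Ψ p).1.1 = d2 p.1.1 ∧
           d0 (Ψ p).1.2 = d0 p.1.1 ∧ d1 (Ψ p).1.2 = d1 p.1.2) :
    (∀ m, D0 (d2 m) = D1 (d0 m)) ∧
    (∀ m, D1 (d2 m) = D1 (d1 m)) ∧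
    (∀ m, D0 (d1 m) = D0 (d0 m)) ∧
    (∀ u, D0 (s00 u) = u) ∧
    (∀ u, D1 (s00 u) = u) ∧
    (∀ u, S1 (s00 u) = S0 (s00 u)) := by
  obtain ⟨ea, hea⟩ := ha4
  obtain ⟨eb, heb⟩ := hb4
  obtain ⟨Ψ, hΨ⟩ := hc
  have A : ∀ e m, s00 e = d0 m → m = S1 (d1 m) ∧ e = D0 (d1 m) := by
    intro e m h
    obtain ⟨x, hx⟩ := ea.surjective ⟨(e, m), h⟩
    have h1 := hea x
    rw [hx] at h1
    obtain ⟨h2, h3⟩ := Prod.mk.inj h1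
    subst h3
    rw [ha2]
    exact ⟨rfl, h2⟩
  have B : ∀ e m, s00 e = d2 m → m = S0 (d0 m) ∧ e = D1 (d0 m) ∧ d0 m = d1 m := by
    intro e m h
    obtain ⟨x, hx⟩ := eb.surjective ⟨(e, m), h⟩
    have h1 := heb x
    rw [hx] at h1
    obtain ⟨h2, h3⟩ := Prod.mk.inj h1
    subst h3
    rw [hb1, hb2]
    exact ⟨rfl, h2, rfl⟩
  refine ⟨?_, ?_, ?_, ?_, ?_, ?_⟩
  · intro k
    obtain ⟨⟨⟨m, m'⟩, hm⟩, hp⟩ := Ψ.surjective ⟨(S1 (d2 k), k), ha2 _⟩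
    have h := hΨ ⟨(m, m'), hm⟩
    rw [hp] at h
    obtain ⟨h1, h2, h3, h4⟩ := h
    dsimp only at h1 h2 h3 h4
    rw [ha3] at h2
    rw [(B _ _ h2).2.1, h3]
  · intro k
    obtain ⟨⟨⟨m, m'⟩, hm⟩, hp⟩ := Ψ.surjective ⟨(S0 (d2 k), k), hb2 _⟩
    have h := hΨ ⟨(m, m'), hm⟩
    rw [hp] at h
    obtain ⟨h1, h2, h3, h4⟩ := h
    dsimp only at h1 h2 h3 h4
    rw [hb3] at h1
    obtain ⟨_, h5, h6⟩ := B _ _ h1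
    rw [h5, h6, h4]
  · intro k
    obtain ⟨h1, h2, h3, h4⟩ := hΨ ⟨(S1 (d0 k), k), ha2 _⟩
    dsimp only at h1 h2 h3 h4
    rw [ha3] at h3
    rw [(A _ _ h3.symm).2, h4]
  · intro u
    have h := (A u (S0 (s00 u)) (hb1 _).symm).2
    rw [hb2] at h
    exact h.symm
  · intro u
    obtain ⟨_, h, h'⟩ := B u (S1 (s00 u)) (ha1 _).symm
    rw [h', ha2] at h
    exact h.symm
  · intro u
    have h := (A u (S0 (s00 u)) (hb1 _).symm).1
    rw [hb2] at h
    exact h.symm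
end

section
/- Let 𝒳 be a 2-truncated simplicial set satisfying (U1), (U2) and the Θ-condition, and let α̂ : X1 → X1 be a bijection. Let Q = {(ζ,u) ∈ X2 × X0 : d_1^2(ζ) = α̂(s_0^0(u))}. Then there exists a bijection Φ : X1 → Q with d_2^2((Φ x).1) = x and d_0^2((Φ x).1) = α̂(x) for all x ∈ X1, if and only if there exists a map γ : X1 → X2 such that (1) for all x ∈ X1: d_0^2(γ(x)) = α̂(x), d_2^2(γ(x)) = x, and d_1^2(γ(x)) ∈ α̂(s_0^0(X0)); and (2) every ζ ∈ X2 with d_1^2(ζ) ∈ α̂(s_0^0(X0)) lies in the range of γ. (The left-hand condition says that the composite morphism ε∘μ in the category Span, where μ is represented by the span (X2, (d_2^2, d_0^2), d_1^2) and ε by the span (X0, α̂∘s_0^0, !), equals the pairing α represented by the span (X1, (id, α̂), !); i.e., X1 is a Frobenius object in Span.) -/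
/-- Frobenius criterion (Theorem on Frobenius objects in Span): for a 2-truncated
simplicial set satisfying (U1), (U2) and the Θ-condition, with a bijection
`α̂ : X1 → X1`, the pairing `ε∘μ` (computed by the pullback
`Q = {(ζ,u) : d_1^2 ζ = α̂(s_0^0 u)}`) equals the nondegenerate pairing
`(X1, (id, α̂), !)` — i.e. there is a bijection `Φ : X1 → Q` with
`d_2^2((Φ x).1) = x` and `d_0^2((Φ x).1) = α̂ x` — iff there is a map
`γ : X1 → X2` satisfying conditions (1) and (2). -/
theorem frobenius_iff_gamma (𝒳 : TwoTruncSS)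
    (hU1 : 𝒳.U1) (hU2 : 𝒳.U2) (hΘ : 𝒳.ThetaCond)
    (α : 𝒳.X1 → 𝒳.X1) (hα : Function.Bijective α) :
    (∃ Φ : 𝒳.X1 ≃ {p : 𝒳.X2 × 𝒳.X0 // 𝒳.d21 p.1 = α (𝒳.s00 p.2)},
        ∀ x, 𝒳.d22 (Φ x).1.1 = x ∧ 𝒳.d20 (Φ x).1.1 = α x) ↔
      (∃ γ : 𝒳.X1 → 𝒳.X2,
        (∀ x, 𝒳.d20 (γ x) = α x ∧ 𝒳.d22 (γ x) = x ∧
          𝒳.d21 (γ x) ∈ Set.range (fun u => α (𝒳.s00 u))) ∧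
        (∀ ζ : 𝒳.X2, 𝒳.d21 ζ ∈ Set.range (fun u => α (𝒳.s00 u)) →
          ζ ∈ Set.range γ)) := by
  constructor
  · rintro ⟨Φ, hΦ⟩
    refine ⟨fun x => (Φ x).1.1, fun x => ⟨(hΦ x).2, (hΦ x).1, (Φ x).1.2, (Φ x).2.symm⟩, ?_⟩
    rintro ζ ⟨u, hu⟩
    refine ⟨Φ.symm ⟨(ζ, u), hu.symm⟩, ?_⟩
    simp
  · rintro ⟨γ, h1, h2⟩
    choose u hu using fun x => (h1 x).2.2
    refine ⟨Equiv.ofBijective (fun x => ⟨(γ x, u x), (hu x).symm⟩) ⟨?_, ?_⟩, ?_⟩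
    · intro x y hxy
      have h : γ x = γ y := congrArg (fun p => p.1.1) hxy
      rw [← (h1 x).2.1, h, (h1 y).2.1]
    · rintro ⟨⟨ζ, v⟩, hv⟩
      obtain ⟨x, rfl⟩ := h2 ζ ⟨v, hv.symm⟩
      refine ⟨x, ?_⟩
      have h : 𝒳.s00 (u x) = 𝒳.s00 v := hα.1 ((hu x).trans hv)
      have h' : u x = v := by rw [← 𝒳.ds1 (u x), h, 𝒳.ds1]
      subst h'
      rfl
    · intro x
      exact ⟨(h1 x).2.1, (h1 x).1⟩
end

section
/- Let A, X be sets and α1, α2 : A → X maps, so that (A, (α1, α2), !) is a span from X × X to the one-point set, representing a pairing α : X × X ⇸ • in the category Span. Then α is nondegenerate — i.e., there exist a set B and maps β1, β2 : B → X together with a bijection φ : X → {(a,b) ∈ A × B : α2(a) = β1(b)} satisfying α1((φ x).1) = x and β2((φ x).2) = x for all x ∈ X, and a bijection φ' : X → {(b,a) ∈ B × A : β2(b) = α1(a)} satisfying β1((φ' x).1) = x and α2((φ' x).2) = x for all x ∈ X — if and only if α1 and α2 are both bijections. -/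
/-- A pairing `α : X × X ⇸ •` in the category `Span`, represented by the span
`(A, (α1, α2), !)`, is nondegenerate (admits a copairing `β` represented by
`(B, !, (β1, β2))` satisfying the snake identities, unwound here as the two
bijections `φ` and `φ'` onto the pullbacks computing the snake composites)
if and only if `α1` and `α2` are both bijections. -/
theorem pairing_nondegenerate_iff_legs_bijective
    {A X : Type} (α1 α2 : A → X) :
    (∃ (B : Type) (β1 β2 : B → X)
        (φ : X ≃ {p : A × B // α2 p.1 = β1 p.2})
        (φ' : X ≃ {p : B × A // β2 p.1 = α1 p.2}),
        (∀ x : X, α1 (φ x).1.1 = x ∧ β2 (φ x).1.2 = x) ∧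
        (∀ x : X, β1 (φ' x).1.1 = x ∧ α2 (φ' x).1.2 = x)) ↔
      (Function.Bijective α1 ∧ Function.Bijective α2) := by
  constructor
  · rintro ⟨B, β1, β2, φ, φ', h, h'⟩
    have key : ∀ a b, α2 a = β1 b →
        ((φ (α1 a)).1 = (a, b) ∧ (φ (β2 b)).1 = (a, b) ∧ α1 a = β2 b) := by
      intro a b hab
      obtain ⟨x, hx⟩ := φ.surjective ⟨(a, b), hab⟩
      have h1 := h x
      rw [hx] at h1
      obtain ⟨h1, h2⟩ := h1
      simp only at h1 h2
      refine ⟨?_, ?_, h1.trans h2.symm⟩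
      · rw [h1, hx]
      · rw [h2, hx]
    have key' : ∀ a b, α1 a = β2 b → α2 a = β1 b := by
      intro a b hab
      obtain ⟨x, hx⟩ := φ'.surjective ⟨(b, a), hab.symm⟩
      have h1 := h' x
      rw [hx] at h1
      exact h1.2.trans h1.1.symm
    have sβ : ∀ x, ∃ b, β1 b = x := fun x => ⟨_, (h' x).1⟩
    refine ⟨⟨?_, fun x => ⟨_, (h x).1⟩⟩, ⟨?_, fun x => ⟨_, (h' x).2⟩⟩⟩
    · intro a a' e
      obtain ⟨b, hb⟩ := sβ (α2 a)
      have k := key a b hb.symm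
      have k' := key a' b (key' a' b (e.symm.trans k.2.2))
      exact congrArg Prod.fst (k.2.1.symm.trans k'.2.1)
    · intro a a' e
      obtain ⟨b, hb⟩ := sβ (α2 a)
      have k := key a b hb.symm
      have k' := key a' b (e.symm.trans hb.symm)
      exact congrArg Prod.fst (k.2.1.symm.trans k'.2.1)
  · rintro ⟨h1, h2⟩
    let e1 := Equiv.ofBijective α1 h1
    let e2 := Equiv.ofBijective α2 h2
    have r1 : ∀ x, α1 (e1.symm x) = x := e1.apply_symm_apply
    have r2 : ∀ x, α2 (e2.symm x) = x := e2.apply_symm_apply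
    have l1 : ∀ a, e1.symm (α1 a) = a := e1.symm_apply_apply
    have l2 : ∀ a, e2.symm (α2 a) = a := e2.symm_apply_apply
    refine ⟨A, α2, α1,
      ⟨fun x => ⟨(e1.symm x, e1.symm x), rfl⟩, fun p => α1 p.1.1, r1, ?_⟩,
      ⟨fun x => ⟨(e2.symm x, e2.symm x), rfl⟩, fun p => α2 p.1.1, r2, ?_⟩,
      fun x => ⟨r1 x, r1 x⟩, fun x => ⟨r2 x, r2 x⟩⟩
    · rintro ⟨⟨a, b⟩, hab⟩
      obtain rfl : a = b := h2.1 hab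
      simp [l1]
    · rintro ⟨⟨a, b⟩, hab⟩
      obtain rfl : a = b := h1.1 hab
      simp [l2]
end

section
/- Let 𝒳 be a 2-truncated simplicial set satisfying (U1) and (U2), let C be a set, c : C → X1 a map, and α̂ : X1 → X1 a bijection. Suppose there exists a bijection Φ : X1 → {(ζ,t) ∈ X2 × C : d_1^2(ζ) = c(t)} with d_2^2((Φ x).1) = x and d_0^2((Φ x).1) = α̂(x) for all x ∈ X1. Then there exists a bijection ψ : X0 → C with c ∘ ψ = α̂ ∘ s_0^0. (This says that if the counit ε of a Frobenius object in the category Span is represented by the span (C, c, !) and the pairing ε∘μ equals the span (X1, (id, α̂), !), then ε is also represented by the span (X0, α̂∘s_0^0, !).) -/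
/-- If the counit `ε` of a Frobenius object in `Span` is represented by the span
`(C, c, !)` and the pairing `ε∘μ` equals the span `(X1, (id, α̂), !)` (encoded by
the bijection `Φ` onto the pullback computing `ε∘μ`), then `ε` is also represented
by the span `(X0, α̂∘s_0^0, !)`: there is a bijection `ψ : X0 → C` with
`c ∘ ψ = α̂ ∘ s_0^0`. -/
theorem counit_representative (𝒳 : TwoTruncSS)
    (hU1 : 𝒳.U1) (hU2 : 𝒳.U2)
    {C : Type} (c : C → 𝒳.X1)
    (α : 𝒳.X1 → 𝒳.X1) (hα : Function.Bijective α)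
    (Φ : 𝒳.X1 ≃ {p : 𝒳.X2 × C // 𝒳.d21 p.1 = c p.2})
    (hΦ : ∀ x, 𝒳.d22 (Φ x).1.1 = x ∧ 𝒳.d20 (Φ x).1.1 = α x) :
    ∃ ψ : 𝒳.X0 → C, Function.Bijective ψ ∧ ∀ u, c (ψ u) = α (𝒳.s00 u) := by
  have key : ∀ u, c (Φ (𝒳.s00 u)).1.2 = α (𝒳.s00 u) := by
    intro u
    obtain ⟨y, hy⟩ := hU1 (Φ (𝒳.s00 u)).1.1 ⟨u, (hΦ _).1.symm⟩
    rw [← (Φ (𝒳.s00 u)).2, ← (hΦ (𝒳.s00 u)).2, ← hy, 𝒳.ds3, 𝒳.ds4]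
  refine ⟨fun u => (Φ (𝒳.s00 u)).1.2, ⟨?_, ?_⟩, key⟩
  · intro u v h
    have h1 : α (𝒳.s00 u) = α (𝒳.s00 v) := by
      rw [← key u, ← key v]
      exact congrArg c h
    have h2 := congrArg 𝒳.d10 (hα.1 h1)
    rwa [𝒳.ds1, 𝒳.ds1] at h2
  · intro t
    obtain ⟨x, hx⟩ := Φ.surjective ⟨(𝒳.s01 (c t), t), 𝒳.ds4 _⟩
    have h1 := (hΦ x).1
    rw [hx] at h1
    refine ⟨𝒳.d11 (c t), ?_⟩
    have h2 : 𝒳.s00 (𝒳.d11 (c t)) = x := (𝒳.ds5 _).symm.trans h1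
    simp only [h2, hx]
end

section
/- Let 𝒳 be a 2-truncated simplicial set. Then the commutative square with top map d_0^1 : X1 → X0, left map s_1^1 : X1 → X2, right map s_0^0 : X0 → X1 and bottom map d_0^2 : X2 → X1 is a pullback square of sets (i.e., the map x ↦ (d_0^1 x, s_1^1 x) is a bijection from X1 onto {(u,ζ) ∈ X0 × X2 : s_0^0(u) = d_0^2(ζ)}) if and only if condition (U2) holds. Similarly, the commutative square with top map d_1^1 : X1 → X0, left map s_0^1 : X1 → X2, right map s_0^0 : X0 → X1 and bottom map d_2^2 : X2 → X1 is a pullback square if and only if condition (U1) holds. (These pullback conditions are the lowest-dimensional unital 2-Segal conditions.) -/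
/-- The lowest-dimensional unital 2-Segal conditions: in a 2-truncated simplicial
set, the square with top `d_0^1`, left `s_1^1`, right `s_0^0`, bottom `d_0^2` is a
pullback iff (U2) holds, and the square with top `d_1^1`, left `s_0^1`, right
`s_0^0`, bottom `d_2^2` is a pullback iff (U1) holds. -/
theorem unital_two_segal_iff_U1_U2 (𝒳 : TwoTruncSS) :
    (Function.Bijective (fun x : 𝒳.X1 =>
        (⟨(𝒳.d10 x, 𝒳.s11 x), (𝒳.ds6 x).symm⟩ :
          {p : 𝒳.X0 × 𝒳.X2 // 𝒳.s00 p.1 = 𝒳.d20 p.2})) ↔ 𝒳.U2) ∧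
    (Function.Bijective (fun x : 𝒳.X1 =>
        (⟨(𝒳.d11 x, 𝒳.s01 x), (𝒳.ds5 x).symm⟩ :
          {p : 𝒳.X0 × 𝒳.X2 // 𝒳.s00 p.1 = 𝒳.d22 p.2})) ↔ 𝒳.U1) := by
  constructor
  · constructor
    · rintro ⟨_, hs⟩ ζ ⟨u, hu⟩
      obtain ⟨x, hx⟩ := hs ⟨(u, ζ), hu⟩
      exact ⟨x, congrArg (fun p => p.1.2) hx⟩
    · intro h
      refine ⟨fun x y hxy => ?_, ?_⟩
      · have h2 := congrArg (fun p => 𝒳.d21 p.1.2) hxy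
        simpa only [𝒳.ds7] using h2
      · rintro ⟨⟨u, ζ⟩, hu⟩
        obtain ⟨x, rfl⟩ := h ζ ⟨u, hu⟩
        refine ⟨x, Subtype.ext (Prod.ext ?_ rfl)⟩
        have h3 : 𝒳.s00 u = 𝒳.s00 (𝒳.d10 x) := hu.trans (𝒳.ds6 x)
        have h4 := congrArg 𝒳.d10 h3
        rw [𝒳.ds1, 𝒳.ds1] at h4
        exact h4.symm
  · constructor
    · rintro ⟨_, hs⟩ ζ ⟨u, hu⟩
      obtain ⟨x, hx⟩ := hs ⟨(u, ζ), hu⟩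
      exact ⟨x, congrArg (fun p => p.1.2) hx⟩
    · intro h
      refine ⟨fun x y hxy => ?_, ?_⟩
      · have h2 := congrArg (fun p => 𝒳.d21 p.1.2) hxy
        simpa only [𝒳.ds4] using h2
      · rintro ⟨⟨u, ζ⟩, hu⟩
        obtain ⟨x, rfl⟩ := h ζ ⟨u, hu⟩
        refine ⟨x, Subtype.ext (Prod.ext ?_ rfl)⟩
        have h3 : 𝒳.s00 u = 𝒳.s00 (𝒳.d11 x) := hu.trans (𝒳.ds5 x)
        have h4 := congrArg 𝒳.d10 h3
        rw [𝒳.ds1, 𝒳.ds1] at h4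
        exact h4.symm
end

section
/- For all natural numbers n and g, let A be the 2×2 matrix over the natural numbers with entries A₀₀ = 2, A₀₁ = n, A₁₀ = n, A₁₁ = n² + 1. Then (1 + n²) * ((A^g)₀₀) = (n² + 2)^g + n². -/
theorem partition_aux (n g : ℕ) :
    (1 + n ^ 2) * (((!![2, n; n, n ^ 2 + 1] : Matrix (Fin 2) (Fin 2) ℕ) ^ g) 0 0) =
      (n ^ 2 + 2) ^ g + n ^ 2 ∧
    (1 + n ^ 2) * (((!![2, n; n, n ^ 2 + 1] : Matrix (Fin 2) (Fin 2) ℕ) ^ g) 0 1) + n =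
      n * (n ^ 2 + 2) ^ g := by
  induction g with
  | zero => simp
  | succ k ih =>
    obtain ⟨h1, h2⟩ := ih
    rw [pow_succ (!![2, n; n, n ^ 2 + 1] : Matrix (Fin 2) (Fin 2) ℕ) k, Matrix.mul_apply, Matrix.mul_apply]
    simp only [Fin.sum_univ_two]
    generalize ((!![2, n; n, n ^ 2 + 1] : Matrix (Fin 2) (Fin 2) ℕ) ^ k) 0 0 = a at *
    generalize ((!![2, n; n, n ^ 2 + 1] : Matrix (Fin 2) (Fin 2) ℕ) ^ k) 0 1 = b at *
    simp only [Matrix.of_apply, Matrix.cons_val', Matrix.cons_val_zero, Matrix.cons_val_one,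
      Matrix.cons_val_fin_one]
    zify at *
    constructor
    · linear_combination 2 * h1 + n * h2
    · linear_combination n * h1 + (n ^ 2 + 1) * h2

/-- The genus-`g` partition function of the two-element Frobenius object in `Span`
with `α̂ = id`, `n_bab = 1`, `n_bbb = n`: for the trajectory-count matrix
`A = !![2, n; n, n² + 1]` one has `(1 + n²) * (A^g)₀₀ = (n² + 2)^g + n²`. -/
theorem two_element_partition_function_identity (n g : ℕ) :
    (1 + n ^ 2) *
      (((!![2, n; n, n ^ 2 + 1] : Matrix (Fin 2) (Fin 2) ℕ) ^ g) 0 0) =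
      (n ^ 2 + 2) ^ g + n ^ 2 := by
  exact (partition_aux n g).1
end
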